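/- Let k ≥ 2 and j ≥ 1 be integers, let w be the unique infinite word beginning with a that is a fixed point of the substitution a ↦ aᵏb, b ↦ aʲ, and for n ≥ 1 let p_n be the position of the n-th occurrence of a in w and q_n the position of the n-th occurrence of b in w (positions 1-indexed). Then for every n ≥ 1, either (p_{n+1} − p_n, q_{n+1} − q_n) = (1, k+1) or (p_{n+1} − p_n, q_{n+1} − q_n) = (2, j+k+1). -/

import Mathlib

inductive AB : Type | A | B
  deriving DecidableEq

/-- The substitution `a ↦ aᵏb`, `b ↦ aʲ`. -/
def σ (k j : ℕ) : AB → List AB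
  | .A => List.replicate k AB.A ++ [AB.B]
  | .B => List.replicate j AB.A

/-- The `n`-th iterate `σⁿ(a)`. -/
def σIter (k j n : ℕ) : List AB := (fun l => l.flatMap (σ k j))^[n] [AB.A]

/-- The unique infinite word (0-indexed) beginning with `a` that is a fixed point of
`σ` (for `k ≥ 2`, `j ≥ 1`); since then `σⁿ⁺¹(a)` has length greater than `n` and each
`σⁿ(a)` is a prefix of `σⁿ⁺¹(a)`, its `n`-th letter is the `n`-th letter of
`σⁿ⁺¹(a)`. -/
def w (k j n : ℕ) : AB := (σIter k j (n + 1)).getD n AB.A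

/-- The position (1-indexed) of the `n`-th occurrence (`n ≥ 1`) of the letter `x`
in the infinite word `w k j` (with letters at 0-indexed places). -/
noncomputable def occ (k j : ℕ) (x : AB) (n : ℕ) : ℕ :=
  Nat.nth (fun i => w k j i = x) (n - 1) + 1

theorem σ_ne_nil {k j : ℕ} (hj : 1 ≤ j) (x : AB) : σ k j x ≠ [] := by
  cases x
  · simp [σ]
  · simp [σ]; omega

theorem σIter_succ (k j n : ℕ) : σIter k j (n + 1) = (σIter k j n).flatMap (σ k j) := by
  simp only [σIter, Function.iterate_succ_apply']

theorem exists_σIter_succ_eq_append {k j : ℕ} (hk : 1 ≤ k) (hj : 1 ≤ j) (n : ℕ) :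
    ∃ t, t ≠ [] ∧ σIter k j (n + 1) = σIter k j n ++ t := by
  induction n with
  | zero =>
    obtain ⟨k, rfl⟩ : ∃ c, k = c + 1 := ⟨k - 1, by omega⟩
    exact ⟨List.replicate k AB.A ++ [AB.B], by simp, by simp [σIter, σ, List.replicate_succ]⟩
  | succ n ih =>
    obtain ⟨t, ht, h⟩ := ih
    refine ⟨t.flatMap (σ k j), ?_, ?_⟩
    · obtain ⟨x, t, rfl⟩ := List.exists_cons_of_ne_nil ht
      simp [σ_ne_nil hj]
    · rw [σIter_succ, h, List.flatMap_append, ← σIter_succ, h]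

theorem σIter_isPrefix {k j : ℕ} (hk : 1 ≤ k) (hj : 1 ≤ j) {m n : ℕ} (h : m ≤ n) :
    σIter k j m <+: σIter k j n := by
  induction n, h using Nat.le_induction with
  | base => exact List.prefix_refl _
  | succ n _ ih =>
    obtain ⟨t, -, ht⟩ := exists_σIter_succ_eq_append hk hj n
    exact ih.trans ⟨t, ht.symm⟩

theorem lt_length_σIter {k j : ℕ} (hk : 1 ≤ k) (hj : 1 ≤ j) (n : ℕ) :
    n < (σIter k j n).length := by
  induction n with
  | zero => simp [σIter]
  | succ n ih =>
    obtain ⟨t, ht, h⟩ := exists_σIter_succ_eq_append hk hj n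
    have := List.length_pos_iff.mpr ht
    rw [h, List.length_append]
    omega

theorem σIter_getElem?_eq_w {k j : ℕ} (hk : 1 ≤ k) (hj : 1 ≤ j) {n i : ℕ}
    (h : i < (σIter k j n).length) : (σIter k j n)[i]? = some (w k j i) := by
  have h' : i < (σIter k j (i + 1)).length :=
    (Nat.lt_succ_self i).trans (lt_length_σIter hk hj (i + 1))
  have hw : (σIter k j (i + 1))[i]? = some (w k j i) := by
    simp [w, List.getD_eq_getElem?_getD, List.getElem?_eq_getElem h']
  rw [← hw]
  rcases le_total n (i + 1) with hle | hle
  · obtain ⟨t, ht⟩ := σIter_isPrefix hk hj hle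
    rw [← ht, List.getElem?_append_left h]
  · obtain ⟨t, ht⟩ := σIter_isPrefix hk hj hle
    rw [← ht, List.getElem?_append_left h']

theorem map_w_range_isPrefix {k j : ℕ} (hk : 1 ≤ k) (hj : 1 ≤ j) (m : ℕ) :
    (List.range m).map (w k j) <+: σIter k j m := by
  rw [List.prefix_iff_getElem?]
  intro i hi
  simp only [List.length_map, List.length_range] at hi
  rw [σIter_getElem?_eq_w hk hj (hi.trans (lt_length_σIter hk hj m))]
  simp

/-- The length of the image under `σ` of the prefix of length `m` of `w k j`. -/
def imageLength (k j m : ℕ) : ℕ := (((List.range m).map (w k j)).flatMap (σ k j)).length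

theorem imageLength_succ (k j m : ℕ) :
    imageLength k j (m + 1) = imageLength k j m + (σ k j (w k j m)).length := by
  simp [imageLength, List.range_succ]

/-- The word `w k j` is fixed by `σ k j`, block by block. -/
theorem w_imageLength_add {k j : ℕ} (hk : 1 ≤ k) (hj : 1 ≤ j) {m r : ℕ}
    (hr : r < (σ k j (w k j m)).length) :
    w k j (imageLength k j m + r) = (σ k j (w k j m))[r] := by
  obtain ⟨t, ht⟩ := map_w_range_isPrefix hk hj (m + 1)
  have hs : ((List.range m).map (w k j)).flatMap (σ k j) ++
      (σ k j (w k j m) ++ t.flatMap (σ k j)) = σIter k j (m + 2) := by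
    rw [σIter_succ, ← ht]
    simp [List.range_succ]
  have hg : (σIter k j (m + 2))[imageLength k j m + r]? = some (σ k j (w k j m))[r] := by
    rw [← hs, List.getElem?_append_right (by simp [imageLength])]
    rw [imageLength, Nat.add_sub_cancel_left, List.getElem?_append_left hr,
      List.getElem?_eq_getElem hr]
  have hl := (List.getElem?_eq_some_iff.mp hg).1
  rw [σIter_getElem?_eq_w hk hj hl] at hg
  exact Option.some.inj hg

theorem imageLength_strictMono {k j : ℕ} (hj : 1 ≤ j) : StrictMono (imageLength k j) :=
  strictMono_nat_of_lt_succ fun m => by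
    rw [imageLength_succ]
    have := List.length_pos_iff.mpr (σ_ne_nil (k := k) hj (w k j m))
    omega

theorem exists_eq_imageLength_add {k j : ℕ} (hj : 1 ≤ j) (i : ℕ) :
    ∃ m r, r < (σ k j (w k j m)).length ∧ i = imageLength k j m + r := by
  have hpos (m : ℕ) := List.length_pos_iff.mpr (σ_ne_nil (k := k) hj (w k j m))
  induction i with
  | zero => exact ⟨0, 0, hpos 0, by simp [imageLength]⟩
  | succ i ih =>
    obtain ⟨m, r, hr, rfl⟩ := ih
    by_cases h : r + 1 < (σ k j (w k j m)).length
    · exact ⟨m, r + 1, h, rfl⟩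
    · refine ⟨m + 1, 0, hpos _, ?_⟩
      rw [imageLength_succ]
      omega

theorem exists_of_w_eq_B {k j : ℕ} (hk : 1 ≤ k) (hj : 1 ≤ j) {i : ℕ} (hi : w k j i = AB.B) :
    ∃ m, w k j m = AB.A ∧ i = imageLength k j m + k := by
  obtain ⟨m, r, hr, rfl⟩ := exists_eq_imageLength_add (k := k) hj i
  rw [w_imageLength_add hk hj hr] at hi
  cases hm : w k j m with
  | A =>
    refine ⟨m, hm, ?_⟩
    simp only [hm, σ, List.length_append, List.length_replicate, List.length_singleton] at hr hi
    by_contra hne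
    have hlt : r < k := by omega
    rw [List.getElem_append_left (by simpa using hlt)] at hi
    simp at hi
  | B => simp [hm, σ] at hi

theorem imageLength_succ_of_A {k j m : ℕ} (hm : w k j m = AB.A) :
    imageLength k j (m + 1) = imageLength k j m + k + 1 := by
  simp [imageLength_succ, hm, σ, add_assoc]

theorem imageLength_succ_of_B {k j m : ℕ} (hm : w k j m = AB.B) :
    imageLength k j (m + 1) = imageLength k j m + j := by
  simp [imageLength_succ, hm, σ]

theorem w_succ_of_w_eq_B {k j : ℕ} (hk : 1 ≤ k) (hj : 1 ≤ j) {i : ℕ} (hi : w k j i = AB.B) :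
    w k j (i + 1) = AB.A := by
  cases h : w k j (i + 1) with
  | A => rfl
  | B =>
    obtain ⟨m, hm, h₁⟩ := exists_of_w_eq_B hk hj hi
    obtain ⟨m', -, h₂⟩ := exists_of_w_eq_B hk hj h
    have hlt : m < m' := (imageLength_strictMono (k := k) hj).lt_iff_lt.mp (by omega)
    have := (imageLength_strictMono (k := k) hj).monotone (Nat.succ_le_of_lt hlt)
    rw [Nat.succ_eq_add_one, imageLength_succ_of_A hm] at this
    omega

theorem infinite_setOf_w_eq_A {k j : ℕ} (hk : 1 ≤ k) (hj : 1 ≤ j) :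
    {i | w k j i = AB.A}.Infinite := by
  refine Set.infinite_of_not_bddAbove ?_
  rintro ⟨N, hN⟩
  cases h : w k j (N + 1) with
  | A => exact absurd (hN h) (by omega)
  | B => exact absurd (hN (w_succ_of_w_eq_B hk hj h)) (by omega)

/-- The last letter of the `m`-th block is `b` exactly when that block is the image of `a`. -/
theorem w_imageLength_succ_sub_one_eq_B_iff {k j : ℕ} (hk : 1 ≤ k) (hj : 1 ≤ j) (m : ℕ) :
    w k j (imageLength k j (m + 1) - 1) = AB.B ↔ w k j m = AB.A := by
  have hpos := List.length_pos_iff.mpr (σ_ne_nil (k := k) hj (w k j m))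
  rw [imageLength_succ, Nat.add_sub_assoc hpos, w_imageLength_add hk hj (by omega)]
  have hx : w k j m = AB.A ∨ w k j m = AB.B := by cases w k j m <;> simp
  rcases hx with hx | hx <;> simp [hx, σ]

theorem nth_w_eq_B {k j : ℕ} (hk : 1 ≤ k) (hj : 1 ≤ j) (n : ℕ) :
    Nat.nth (fun i => w k j i = AB.B) n + 1 =
      imageLength k j (Nat.nth (fun i => w k j i = AB.A) n + 1) := by
  have hmono := imageLength_strictMono (k := k) hj
  have hpos (m : ℕ) : 0 < imageLength k j (m + 1) := (Nat.zero_le _).trans_lt (hmono m.succ_pos)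
  have hf : StrictMono fun m => imageLength k j (m + 1) - 1 := by
    intro a b hab
    have := hmono (Nat.succ_lt_succ hab)
    have := hpos a
    simp only [Nat.succ_eq_add_one] at *
    omega
  have key := Nat.nth_comp_of_strictMono (p := fun i => w k j i = AB.B) (n := n) hf
    (fun i hi => by
      obtain ⟨m, hm, rfl⟩ := exists_of_w_eq_B hk hj hi
      exact ⟨m, by simp [imageLength_succ_of_A hm]⟩)
    (fun hfin => by
      refine absurd (hfin.preimage hf.injective.injOn) ?_
      rw [← Set.Infinite]
      simpa only [Set.preimage_ofPred_eq, w_imageLength_succ_sub_one_eq_B_iff hk hj] using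
        infinite_setOf_w_eq_A hk hj)
  simp only [w_imageLength_succ_sub_one_eq_B_iff hk hj] at key
  rw [← key, Nat.sub_add_cancel (hpos _)]

/-- Let `k ≥ 2`, `j ≥ 1`, and let `pₙ`, `qₙ` be the positions of the `n`-th `a`,
resp. `b`, in the fixed point of `a ↦ aᵏb`, `b ↦ aʲ`.  Then for every `n ≥ 1`, either
`(p_{n+1} − pₙ, q_{n+1} − qₙ) = (1, k+1)` or `(p_{n+1} − pₙ, q_{n+1} − qₙ) = (2, j+k+1)`. -/
theorem occ_successive_differences (k j : ℕ) (hk : 2 ≤ k) (hj : 1 ≤ j)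
    (n : ℕ) (hn : 1 ≤ n) :
    (occ k j AB.A (n + 1) - occ k j AB.A n = 1 ∧
      occ k j AB.B (n + 1) - occ k j AB.B n = k + 1) ∨
    (occ k j AB.A (n + 1) - occ k j AB.A n = 2 ∧
      occ k j AB.B (n + 1) - occ k j AB.B n = j + k + 1) := by
  obtain ⟨n, rfl⟩ : ∃ c, n = c + 1 := ⟨n - 1, by omega⟩
  have hk : 1 ≤ k := by omega
  have hinf := infinite_setOf_w_eq_A hk hj
  simp only [occ, Nat.add_sub_cancel, nth_w_eq_B hk hj]
  have hp : w k j (Nat.nth (fun i => w k j i = AB.A) n) = AB.A := Nat.nth_mem_of_infinite hinf n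
  have hc : Nat.count (fun i => w k j i = AB.A)
      (Nat.nth (fun i => w k j i = AB.A) n + 1) = n + 1 := by
    rw [Nat.count_succ, Nat.count_nth_of_infinite hinf, if_pos hp]
  set p := Nat.nth (fun i => w k j i = AB.A) n
  cases h : w k j (p + 1) with
  | A =>
    have hnext : Nat.nth (fun i => w k j i = AB.A) (n + 1) = p + 1 := by
      rw [← hc]
      exact Nat.nth_count (p := fun i => w k j i = AB.A) h
    rw [hnext, imageLength_succ_of_A h]
    omega
  | B =>
    have h' := w_succ_of_w_eq_B hk hj h
    have hnext : Nat.nth (fun i => w k j i = AB.A) (n + 1) = p + 1 + 1 := by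
      rw [← Nat.nth_count (p := fun i => w k j i = AB.A) h', Nat.count_succ, hc]
      simp [h]
    rw [hnext, imageLength_succ_of_A h', imageLength_succ_of_B h]
    omega
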